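/- Asymptotic expansion of the ground state: let d ≥ 11 and p > p_JL. There exist constants a₁ ≠ 0, c ≠ 0 and δ(p) > 0 such that, for every 0 < g < min(α, α₂−α) and every integer k ≥ 0: (i) ∂_y^k Q(y) = ∂_y^k[c_∞ y^{−2/(p−1)} + a₁ y^{−γ}] + O(y^{−γ−g−k}) as y → ∞; (ii) ∂_y^k Λ^{(1)}Q(y) = ∂_y^k[c·y^{−γ}] + O(y^{−γ−g−k}) as y → ∞; (iii) the linearized operator L = −Δ − pQ^{p−1} satisfies the Hardy-type positivity bound ∫_{ℝ^d}(|∇u|² − pQ^{p−1}u²) ≥ δ(p)∫_{ℝ^d} u²/|y|² for every u ∈ H¹(ℝ^d); (iv) Λ^{(1)}Q(y) > 0 for every y ≥ 0. -/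

import Mathlib

noncomputable section

open Real MeasureTheory Filter Asymptotics Set Topology ENNReal

namespace WaveBlowup

/-- The Joseph–Lundgren exponent `p_JL = 1 + 4/(d-4-2√(d-1))`. -/
def pJL (d : ℕ) : ℝ := 1 + 4 / ((d : ℝ) - 4 - 2 * Real.sqrt ((d : ℝ) - 1))

/-- The critical Sobolev exponent `s_c = d/2 - 2/(p-1)`. -/
def sCrit (d : ℕ) (p : ℝ) : ℝ := (d : ℝ) / 2 - 2 / (p - 1)

/-- `c_∞ = [(2/(p-1))(d-2-2/(p-1))]^{1/(p-1)}`. -/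
def cInfty (d : ℕ) (p : ℝ) : ℝ :=
  ((2 / (p - 1)) * ((d : ℝ) - 2 - 2 / (p - 1))) ^ ((1 : ℝ) / (p - 1))

/-- `△ = (d-2)² - 4 p c_∞^{p-1}`. -/
def discr (d : ℕ) (p : ℝ) : ℝ := ((d : ℝ) - 2) ^ 2 - 4 * p * cInfty d p ^ (p - 1)

/-- `γ = (d-2-√△)/2`. -/
def gam (d : ℕ) (p : ℝ) : ℝ := (((d : ℝ) - 2) - Real.sqrt (discr d p)) / 2

/-- `α = γ - 2/(p-1)`, the smaller root of `X² - (d-2-4/(p-1))X + 2(d-2-2/(p-1))`. -/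
def alph (d : ℕ) (p : ℝ) : ℝ := gam d p - 2 / (p - 1)

/-- `α₂`, the other root of the same quadratic (the sum of the roots is `d-2-4/(p-1)`). -/
def alph₂ (d : ℕ) (p : ℝ) : ℝ := ((d : ℝ) - 2 - 4 / (p - 1)) - alph d p

/-- `k₀ = ⌊d/2 - γ⌋`. -/
def kzero (d : ℕ) (p : ℝ) : ℕ := ⌊(d : ℝ) / 2 - gam d p⌋₊

/-- `δ₀ = d/2 - γ - k₀ ∈ (0,1)`. -/
def deltazero (d : ℕ) (p : ℝ) : ℝ := (d : ℝ) / 2 - gam d p - (kzero d p : ℝ)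

/-- `g = min(α, α₂ - α) - ε`. -/
def gconst (d : ℕ) (p ε : ℝ) : ℝ := min (alph d p) (alph₂ d p - alph d p) - ε

/-- `g' = min(g, 2, 1 + δ₀ - ε)`. -/
def gpconst (d : ℕ) (p ε : ℝ) : ℝ := min (gconst d p ε) (min 2 (1 + deltazero d p - ε))

/-- The ground state `Q` in radial representation: the unique smooth positive radially
symmetric solution of `ΔQ + Q^p = 0` on `ℝ^d` with `Q(0) = 1`. -/
structure IsGroundState (d : ℕ) (p : ℝ) (Q : ℝ → ℝ) : Prop where
  smooth : ContDiff ℝ (⊤ : ℕ∞) Q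
  pos : ∀ y : ℝ, 0 ≤ y → 0 < Q y
  ode : ∀ y : ℝ, 0 < y →
    deriv (deriv Q) y + ((d : ℝ) - 1) / y * deriv Q y + Q y ^ p = 0
  at0 : Q 0 = 1
  deriv0 : deriv Q 0 = 0

/-- `Λ⁽¹⁾Q = (2/(p-1) + y ∂_y) Q`. -/
def Lam1 (p : ℝ) (Q : ℝ → ℝ) : ℝ → ℝ := fun y => 2 / (p - 1) * Q y + y * deriv Q y

/-- The potential `W = ∂_y (log Λ⁽¹⁾Q)`. -/
def Wpot (p : ℝ) (Q : ℝ → ℝ) : ℝ → ℝ := fun y => deriv (fun z => Real.log (Lam1 p Q z)) y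

/-- `A u = -∂_y u + W u`. -/
def Aop (p : ℝ) (Q : ℝ → ℝ) (u : ℝ → ℝ) : ℝ → ℝ :=
  fun y => -deriv u y + Wpot p Q y * u y

/-- `A* u = y^{1-d} ∂_y (y^{d-1} u) + W u`. -/
def Astar (d : ℕ) (p : ℝ) (Q : ℝ → ℝ) (u : ℝ → ℝ) : ℝ → ℝ :=
  fun y => deriv (fun z => z ^ (d - 1) * u z) y / y ^ (d - 1) + Wpot p Q y * u y

/-- The linearized operator `L = -Δ - pQ^{p-1}` on radial functions. -/
def Lop (d : ℕ) (p : ℝ) (Q : ℝ → ℝ) (u : ℝ → ℝ) : ℝ → ℝ :=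
  fun y => -(deriv (deriv u) y + ((d : ℝ) - 1) / y * deriv u y) - p * Q y ^ (p - 1) * u y

/-- Adapted derivatives: `u_0 = u`, `u_{k+1} = A u_k` for `k` even, `u_{k+1} = A* u_k`
for `k` odd. -/
def adap (d : ℕ) (p : ℝ) (Q : ℝ → ℝ) : ℕ → (ℝ → ℝ) → (ℝ → ℝ)
  | 0, u => u
  | (k+1), u => if k % 2 = 0 then Aop p Q (adap d p Q k u) else Astar d p Q (adap d p Q k u)

/-- Trajectories of the autonomous (Emden–Fowler) form of the equation. -/
structure Emden (p c a b : ℝ) (v : ℝ → ℝ) : Prop where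
  hp : 1 < p
  hc : 0 < c
  ha : 0 < a
  hab : a < b
  hB : a * b = (p - 1) * c ^ (p - 1)
  smooth : ContDiff ℝ (⊤ : ℕ∞) v
  pos : ∀ t, 0 < v t
  ode : ∀ t, deriv (deriv v) t = c ^ (p - 1) * v t - v t ^ p - (a + b) * deriv v t
  lim0 : Tendsto v atBot (𝓝 0)
  lim1 : Tendsto (deriv v) atBot (𝓝 0)

/-- Remainder `R(c - v)`. -/
def rem (p c a b : ℝ) (v : ℝ → ℝ) : ℝ → ℝ :=
  fun t => a * b * (c - v t) - (c ^ (p - 1) * v t - v t ^ p)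

lemma rpow_pred_mul {x p : ℝ} (hx : 0 < x) : x ^ (p - 1) * x = x ^ p := by
  rw [← Real.rpow_add_one hx.ne']; congr 1; ring

/-- tangent line inequality -/
lemma tangent {p c x : ℝ} (hp : 1 < p) (hc : 0 < c) (hx : 0 < x) :
    c ^ (p - 1) * x - x ^ p ≤ (p - 1) * c ^ (p - 1) * (c - x) := by
  have h := one_add_mul_self_le_rpow_one_add (s := x / c - 1)
    (by have := div_pos hx hc; linarith) hp.le
  have e : (1 + (x / c - 1)) = x / c := by ring
  rw [e, Real.div_rpow hx.le hc.le] at h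
  have hcp : 0 < c ^ p := Real.rpow_pos_of_pos hc p
  rw [le_div_iff₀ hcp, ← rpow_pred_mul hc] at h
  have : (1 + p * (x / c - 1)) * (c ^ (p - 1) * c) = c ^ (p - 1) * (c + p * (x - c)) := by
    field_simp
  rw [this] at h
  nlinarith

namespace Emden
variable {p c a b : ℝ} {v : ℝ → ℝ}

lemma hb (h : Emden p c a b v) : 0 < b := h.ha.trans h.hab

lemma d1 (h : Emden p c a b v) (t : ℝ) : HasDerivAt v (deriv v t) t :=
  ((h.smooth.differentiable (by simp)) t).hasDerivAt

lemma smooth' (h : Emden p c a b v) : ContDiff ℝ (⊤ : ℕ∞) (deriv v) := by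
  have := h.smooth
  exact (contDiff_infty_iff_deriv.1 this).2

lemma d2 (h : Emden p c a b v) (t : ℝ) : HasDerivAt (deriv v) (deriv (deriv v) t) t :=
  ((h.smooth'.differentiable (by simp)) t).hasDerivAt

lemma rem_nonneg (h : Emden p c a b v) (t : ℝ) : 0 ≤ rem p c a b v t := by
  have := tangent h.hp h.hc (h.pos t)
  unfold rem; rw [h.hB]; linarith

lemma expd (k t : ℝ) : HasDerivAt (fun t => exp (k * t)) (k * exp (k * t)) t := by
  have := ((hasDerivAt_id t).const_mul k).exp
  simpa [mul_comm] using this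

/-- `ψ = φ' + a φ` equation. -/
lemma psi_d (h : Emden p c a b v) (t : ℝ) :
    HasDerivAt (fun t => exp (b * t) * (a * (c - v t) - deriv v t))
      (exp (b * t) * rem p c a b v t) t := by
  have := (expd b t).mul ((((h.d1 t).const_sub c).const_mul a).sub (h.d2 t))
  refine this.congr_deriv ?_
  simp only [rem, h.ode, Pi.sub_apply]; ring

lemma chi_d (h : Emden p c a b v) (t : ℝ) :
    HasDerivAt (fun t => exp (a * t) * (b * (c - v t) - deriv v t))
      (exp (a * t) * rem p c a b v t) t := by
  have := (expd a t).mul ((((h.d1 t).const_sub c).const_mul b).sub (h.d2 t))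
  refine this.congr_deriv ?_
  simp only [rem, h.ode, Pi.sub_apply]; ring

lemma exp_bot {k : ℝ} (hk : 0 < k) : Tendsto (fun t => exp (k * t)) atBot (𝓝 0) :=
  Real.tendsto_exp_atBot.comp (tendsto_id.const_mul_atBot hk)

lemma mono_of {f f' : ℝ → ℝ} (h : ∀ t, HasDerivAt f (f' t) t) (h0 : ∀ t, 0 ≤ f' t) :
    Monotone f :=
  monotone_of_deriv_nonneg (fun t => (h t).differentiableAt) (fun t => by rw [(h t).deriv]; exact h0 t)

lemma nonneg_of_bot {f : ℝ → ℝ} (hf : Monotone f) (hl : Tendsto f atBot (𝓝 0)) (t : ℝ) : 0 ≤ f t :=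
  hf.le_of_tendsto hl t

lemma psi_nonneg (h : Emden p c a b v) (t : ℝ) : 0 ≤ a * (c - v t) - deriv v t := by
  have h1 := nonneg_of_bot (mono_of h.psi_d (fun t => mul_nonneg (exp_pos _).le (h.rem_nonneg t)))
    (by simpa using (exp_bot h.hb).mul (((h.lim0.const_sub c).const_mul a).sub h.lim1)) t
  exact nonneg_of_mul_nonneg_right h1 (exp_pos _)

lemma phi_pos (h : Emden p c a b v) (t : ℝ) : 0 < c - v t := by
  have hm : Monotone (fun t => exp (a * t) * (c - v t)) := by
    refine mono_of (f' := fun t => exp (a * t) * (a * (c - v t) - deriv v t)) (fun t => ?_)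
      (fun t => mul_nonneg (exp_pos _).le (h.psi_nonneg t))
    have := (expd a t).mul ((h.d1 t).const_sub c)
    exact this.congr_deriv (by ring)
  have h0 : ∀ᶠ s in atBot, v s < c := h.lim0.eventually (gt_mem_nhds h.hc)
  obtain ⟨s, hs, hst⟩ := (h0.and (eventually_le_atBot t)).exists
  have h1 := hm hst
  have h2 : 0 < exp (a * s) * (c - v s) := mul_pos (exp_pos _) (by linarith)
  exact pos_of_mul_pos_right (h2.trans_le h1) (exp_pos _).le

lemma f_pos (h : Emden p c a b v) (t : ℝ) : 0 < c ^ (p - 1) * v t - v t ^ p := by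
  have h1 : v t ^ (p - 1) < c ^ (p - 1) :=
    Real.rpow_lt_rpow (h.pos t).le (by linarith [h.phi_pos t]) (by linarith [h.hp])
  rw [← rpow_pred_mul (h.pos t)]
  nlinarith [h.pos t]

lemma v'_pos (h : Emden p c a b v) (t : ℝ) : 0 < deriv v t := by
  have hd : ∀ t, HasDerivAt (fun t => exp ((a + b) * t) * deriv v t)
      (exp ((a + b) * t) * (c ^ (p - 1) * v t - v t ^ p)) t := fun t => by
    have := (expd (a + b) t).mul (h.d2 t)
    refine this.congr_deriv ?_
    rw [h.ode]; ring
  have hs : StrictMono (fun t => exp ((a + b) * t) * deriv v t) :=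
    strictMono_of_deriv_pos (fun t => by
      rw [(hd t).deriv]; exact mul_pos (exp_pos _) (h.f_pos t))
  have h1 := nonneg_of_bot hs.monotone
    (by simpa using (exp_bot (add_pos h.ha h.hb)).mul h.lim1) (t - 1)
  have h2 := h1.trans_lt (hs (show t - 1 < t by linarith))
  exact pos_of_mul_pos_right h2 (exp_pos _).le

lemma v_mono (h : Emden p c a b v) : Monotone v := mono_of h.d1 (fun t => (h.v'_pos t).le)

lemma lim_c (h : Emden p c a b v) : Tendsto v atTop (𝓝 c) := by
  have key : ∀ l, l < c → ∃ t, l < v t := by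
    intro l hl
    by_contra hcon
    push Not at hcon
    set κ := v 0 * (c ^ (p - 1) - l ^ (p - 1)) with hκ
    have hl0 : 0 < l := (h.pos 0).trans_le (hcon 0)
    have hκ0 : 0 < κ := mul_pos (h.pos 0)
      (sub_pos.2 (Real.rpow_lt_rpow hl0.le hl (by linarith [h.hp])))
    have hf : ∀ t, 0 ≤ t → κ ≤ c ^ (p - 1) * v t - v t ^ p := fun t ht => by
      rw [← rpow_pred_mul (h.pos t)]
      have h1 : v t ^ (p - 1) ≤ l ^ (p - 1) :=
        Real.rpow_le_rpow (h.pos t).le (hcon t) (by linarith [h.hp])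
      have h2 : l ^ (p - 1) < c ^ (p - 1) := Real.rpow_lt_rpow hl0.le hl (by linarith [h.hp])
      have h3 := h.v_mono ht
      have := mul_le_mul h3 (sub_le_sub_left h1 (c ^ (p - 1))) (by linarith) (h.pos t).le
      linarith
    have hm : MonotoneOn (fun t => deriv v t + (a + b) * v t - κ * t) (Ici 0) := by
      have hd : ∀ t, HasDerivAt (fun t => deriv v t + (a + b) * v t - κ * t)
          (c ^ (p - 1) * v t - v t ^ p - κ) t := fun t => by
        have := ((h.d2 t).add ((h.d1 t).const_mul (a + b))).sub ((hasDerivAt_id t).const_mul κ)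
        refine this.congr_deriv ?_
        rw [h.ode]; ring
      refine monotoneOn_of_deriv_nonneg (convex_Ici 0)
        (fun t _ => (hd t).continuousAt.continuousWithinAt)
        (fun t _ => (hd t).differentiableAt.differentiableWithinAt) (fun t ht => ?_)
      rw [interior_Ici] at ht
      rw [(hd t).deriv]; linarith [hf t (le_of_lt ht)]
    set T := (a * c + (a + b) * c) / κ with hT
    have hT0 : 0 ≤ T := by
      have := h.ha; have := h.hb; have := h.hc; positivity
    have h1 := hm (mem_Ici.2 le_rfl) (mem_Ici.2 hT0) hT0
    simp only [mul_zero, sub_zero] at h1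
    have h2 : κ * T = a * c + (a + b) * c := by rw [hT]; field_simp
    have h3 := h.psi_nonneg T
    have h4 := h.phi_pos T
    have h5 := h.v'_pos 0
    have h6 := h.pos 0
    have h7 := h.pos T
    have := h.ha; have := h.hb
    nlinarith [mul_pos (add_pos h.ha h.hb) h6, mul_pos (add_pos h.ha h.hb) h4, mul_pos h.ha h7]
  refine tendsto_order.2 ⟨fun l hl => ?_, fun l hl => Eventually.of_forall fun t => by
    linarith [h.phi_pos t]⟩
  obtain ⟨t, ht⟩ := key l hl
  filter_upwards [eventually_ge_atTop t] with s hs using ht.trans_le (h.v_mono hs)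

end Emden

/-- If `(e^{βt} h)' = O(e^{(β-μ)t})` with `μ < β` then `h = O(e^{-μ t})`. -/
lemma decay_lt {f q : ℝ → ℝ} {β μ : ℝ} (hμ : μ < β)
    (hd : ∀ t, HasDerivAt (fun t => exp (β * t) * f t) (exp (β * t) * q t) t)
    (hq : q =O[atTop] fun t => exp (-μ * t)) : f =O[atTop] fun t => exp (-μ * t) := by
  obtain ⟨C, hC⟩ := hq.bound
  obtain ⟨T, hT⟩ := eventually_atTop.1 hC
  set K := C / (β - μ) with hK
  have hβ : 0 < β - μ := by linarith
  have hCK : C = K * (β - μ) := by rw [hK]; field_simp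
  have bd : ∀ t, T ≤ t → |exp (β * t) * q t| ≤ K * ((β - μ) * exp ((β - μ) * t)) := fun t ht => by
    have h1 := hT t ht
    simp only [Real.norm_eq_abs, abs_exp] at h1
    rw [abs_mul, abs_exp]
    calc _ ≤ exp (β * t) * (C * exp (-μ * t)) := by gcongr
      _ = C * (exp (β * t) * exp (-μ * t)) := by ring
      _ = K * (β - μ) * exp ((β - μ) * t) := by rw [← exp_add, ← hCK]; ring_nf
      _ = _ := by ring
  have mono : ∀ s : ℝ, |s| = 1 → MonotoneOn (fun t => K * exp ((β - μ) * t) + s * (exp (β * t) * f t)) (Ici T) := by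
    intro s hs
    have hd' : ∀ t, HasDerivAt (fun t => K * exp ((β - μ) * t) + s * (exp (β * t) * f t))
      (K * ((β - μ) * exp ((β - μ) * t)) + s * (exp (β * t) * q t)) t := fun t =>
        ((Emden.expd _ t).const_mul K).add ((hd t).const_mul s)
    refine monotoneOn_of_deriv_nonneg (convex_Ici T)
        (fun t _ => (hd' t).continuousAt.continuousWithinAt)
        (fun t _ => (hd' t).differentiableAt.differentiableWithinAt) (fun t ht => ?_)
    rw [interior_Ici] at ht
    rw [(hd' t).deriv]
    have h1 := bd t (le_of_lt ht)
    have h2 : |s * (exp (β * t) * q t)| ≤ K * ((β - μ) * exp ((β - μ) * t)) := by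
      rw [abs_mul, hs, one_mul]; exact h1
    linarith [(abs_le.1 h2).1]
  have m1 := mono 1 (by simp)
  have m2 := mono (-1) (by simp)
  set M := |K * exp ((β - μ) * T)| + |exp (β * T) * f T| with hM
  have hM0 : 0 ≤ M := by positivity
  refine IsBigO.of_bound (|K| + M) ?_
  filter_upwards [eventually_ge_atTop T, eventually_ge_atTop 0] with t ht ht0
  have a1 := m1 (mem_Ici.2 le_rfl) (mem_Ici.2 ht) ht
  have a2 := m2 (mem_Ici.2 le_rfl) (mem_Ici.2 ht) ht
  simp only at a1 a2
  have b1 : |exp (β * t) * f t| ≤ |K| * exp ((β - μ) * t) + M := by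
    have := le_abs_self K
    have e := exp_pos ((β - μ) * t)
    have := mul_le_mul_of_nonneg_right this e.le
    have c1 := neg_abs_le (K * exp ((β - μ) * T))
    have c2 := neg_abs_le (exp (β * T) * f T)
    have c3 := le_abs_self (exp (β * T) * f T)
    rw [abs_le]; constructor <;> linarith
  have b2 : (1 : ℝ) ≤ exp ((β - μ) * t) := one_le_exp (by positivity)
  simp only [Real.norm_eq_abs, abs_exp]
  rw [abs_mul, abs_exp] at b1
  have b3 : exp (β * t) * |f t| ≤ exp (β * t) * ((|K| + M) * exp (-μ * t)) := by
    calc _ ≤ |K| * exp ((β - μ) * t) + M * 1 := by linarith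
      _ ≤ |K| * exp ((β - μ) * t) + M * exp ((β - μ) * t) := by gcongr
      _ = (|K| + M) * exp (β * t + (-μ * t)) := by ring_nf
      _ = _ := by rw [exp_add]; ring
  exact le_of_mul_le_mul_left b3 (exp_pos _)

/-- If `(e^{βt} h)' = O(e^{(β-μ)t})` with `β < μ`, and monotone, then `h = L e^{-βt} + O(e^{-μ t})`. -/
lemma decay_gt {f q : ℝ → ℝ} {β μ : ℝ} (hμ : β < μ)
    (hd : ∀ t, HasDerivAt (fun t => exp (β * t) * f t) (exp (β * t) * q t) t)
    (hq0 : ∀ t, 0 ≤ q t)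
    (hq : q =O[atTop] fun t => exp (-μ * t)) : ∃ L, (∀ t, exp (β * t) * f t ≤ L) ∧
      (fun t => f t - L * exp (-β * t)) =O[atTop] fun t => exp (-μ * t) := by
  obtain ⟨C, hC⟩ := hq.bound
  obtain ⟨T, hT⟩ := eventually_atTop.1 hC
  set K := C / (μ - β) with hK
  have hβ : 0 < μ - β := by linarith
  have hCK : C = K * (μ - β) := by rw [hK]; field_simp
  have mono0 : Monotone (fun t => exp (β * t) * f t) :=
    Emden.mono_of hd (fun t => mul_nonneg (exp_pos _).le (hq0 t))
  have anti : AntitoneOn (fun t => exp (β * t) * f t + K * exp ((β - μ) * t)) (Ici T) := by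
    have hd' : ∀ t, HasDerivAt (fun t => exp (β * t) * f t + K * exp ((β - μ) * t))
      (exp (β * t) * q t + K * ((β - μ) * exp ((β - μ) * t))) t := fun t =>
        (hd t).add ((Emden.expd _ t).const_mul K)
    refine antitoneOn_of_deriv_nonpos (convex_Ici T)
        (fun t _ => (hd' t).continuousAt.continuousWithinAt)
        (fun t _ => (hd' t).differentiableAt.differentiableWithinAt) (fun t ht => ?_)
    rw [interior_Ici] at ht
    rw [(hd' t).deriv]
    have h1 := hT t (le_of_lt ht)
    simp only [Real.norm_eq_abs, abs_exp] at h1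
    have h2 : exp (β * t) * q t ≤ exp (β * t) * (C * exp (-μ * t)) :=
      mul_le_mul_of_nonneg_left ((le_abs_self _).trans h1) (exp_pos _).le
    have h3 : exp (β * t) * (C * exp (-μ * t)) = C * exp ((β - μ) * t) := by
      rw [mul_left_comm, ← exp_add]; ring_nf
    rw [h3, hCK] at h2
    linarith
  have hC0 : 0 ≤ C := by
    have := (norm_nonneg _).trans (hT T le_rfl)
    rw [Real.norm_eq_abs, abs_exp] at this
    exact nonneg_of_mul_nonneg_left this (exp_pos _)
  have hK0 : 0 ≤ K := div_nonneg hC0 hβ.le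
  have up : ∀ s, T ≤ s → ∀ t, exp (β * t) * f t ≤ exp (β * s) * f s + K * exp ((β - μ) * s) := by
    intro s hs t
    have h1 := anti (mem_Ici.2 hs) (mem_Ici.2 (hs.trans (le_max_left s t))) (le_max_left s t)
    have h2 := mono0 (le_max_right s t)
    simp only at h1 h2
    have : 0 ≤ K * exp ((β - μ) * max s t) := by positivity
    linarith
  have bdd : BddAbove (range fun t => exp (β * t) * f t) :=
    ⟨_, by rintro _ ⟨t, rfl⟩; exact up T le_rfl t⟩
  refine ⟨⨆ t, exp (β * t) * f t, fun t => le_ciSup bdd t, ?_⟩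
  set L := ⨆ t, exp (β * t) * f t
  refine IsBigO.of_bound K ?_
  filter_upwards [eventually_ge_atTop T] with t ht
  have l1 : exp (β * t) * f t ≤ L := le_ciSup bdd t
  have l2 : L ≤ exp (β * t) * f t + K * exp ((β - μ) * t) := ciSup_le (up t ht)
  have e : f t - L * exp (-β * t) = exp (-β * t) * (exp (β * t) * f t - L) := by
    have : exp (-β * t) * exp (β * t) = 1 := by rw [← exp_add]; simp
    linear_combination (-f t) * this
  rw [e]
  simp only [Real.norm_eq_abs, abs_exp, abs_mul]
  have : exp (-μ * t) = exp (-β * t) * exp ((β - μ) * t) := by rw [← exp_add]; ring_nf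
  rw [this]
  have : |exp (β * t) * f t - L| ≤ K * exp ((β - μ) * t) := by rw [abs_le]; constructor <;> linarith [mul_nonneg hK0 (exp_pos ((β - μ) * t)).le]
  calc _ ≤ exp (-β * t) * (K * exp ((β - μ) * t)) := by gcongr
    _ = _ := by ring

namespace Emden
variable {p c a b : ℝ} {v : ℝ → ℝ}

lemma rpow_diff_O (h : Emden p c a b v) (q : ℝ) :
    (fun t => c ^ q - v t ^ q) =O[atTop] fun t => c - v t := by
  have h1 := (Real.hasDerivAt_rpow_const (x := c) (p := q) (Or.inl h.hc.ne')).isBigO_sub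
  have h2 := (h1.comp_tendsto h.lim_c).neg_left.neg_right
  simpa [Function.comp_def] using h2

lemma rem_le (h : Emden p c a b v) (t : ℝ) :
    rem p c a b v t ≤ p * ((c ^ (p - 1) - v t ^ (p - 1)) * (c - v t)) := by
  have h1 := tangent h.hp (h.pos t) h.hc
  rw [← rpow_pred_mul h.hc] at h1
  unfold rem
  rw [h.hB, ← rpow_pred_mul (h.pos t)]
  nlinarith

lemma rem_O (h : Emden p c a b v) :
    rem p c a b v =O[atTop] fun t => (c - v t) * (c - v t) := by
  refine IsBigO.trans ?_ (((h.rpow_diff_O (p - 1)).mul (isBigO_refl (fun t => c - v t) atTop)).const_mul_left p)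
  refine IsBigO.of_bound 1 (Eventually.of_forall fun t => ?_)
  rw [one_mul, Real.norm_eq_abs, abs_of_nonneg (h.rem_nonneg t)]
  exact (h.rem_le t).trans (le_abs_self _)

lemma phi_lim (h : Emden p c a b v) : Tendsto (fun t => c - v t) atTop (𝓝 0) := by
  simpa using h.lim_c.const_sub c

lemma phi_le_chi (h : Emden p c a b v) (t : ℝ) :
    (b - a) * (c - v t) ≤ b * (c - v t) - deriv v t := by
  linarith [h.psi_nonneg t]

/-- bound on `χ` transfers to `φ` -/
lemma phi_O_of_chi (h : Emden p c a b v) {μ C T : ℝ}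
    (hC : ∀ t, T ≤ t → exp (μ * t) * (b * (c - v t) - deriv v t) ≤ C) :
    (fun t => c - v t) =O[atTop] fun t => exp (-μ * t) := by
  refine IsBigO.of_bound (C / (b - a)) ?_
  filter_upwards [eventually_ge_atTop T] with t ht
  rw [Real.norm_eq_abs, Real.norm_eq_abs, abs_exp, abs_of_pos (h.phi_pos t)]
  have hab : 0 < b - a := sub_pos.2 h.hab
  have h1 := hC t ht
  have h2 := mul_le_mul_of_nonneg_left (h.phi_le_chi t) (exp_pos (μ * t)).le
  have h3 : exp (μ * t) * exp (-μ * t) = 1 := by rw [← exp_add]; simp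
  have h4 : exp (μ * t) * (c - v t) ≤ exp (μ * t) * (C / (b - a) * exp (-μ * t)) := by
    have : exp (μ * t) * (C / (b - a) * exp (-μ * t)) = C / (b - a) := by
      linear_combination (C / (b - a)) * h3
    rw [this, le_div_iff₀ hab]
    linarith
  exact le_of_mul_le_mul_left h4 (exp_pos _)

lemma rem_O_of_phi (h : Emden p c a b v) {μ : ℝ}
    (hO : (fun t => c - v t) =O[atTop] fun t => exp (-μ * t)) :
    rem p c a b v =O[atTop] fun t => exp (-(2 * μ) * t) := by
  refine (h.rem_O.trans (hO.mul hO)).congr_right fun t => ?_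
  rw [← exp_add]; ring_nf

lemma phi_O (h : Emden p c a b v) : (fun t => c - v t) =O[atTop] fun t => exp (-a * t) := by
  have hab : 0 < b - a := sub_pos.2 h.hab
  have ho : rem p c a b v =o[atTop] fun t => c - v t := by
    refine h.rem_O.trans_isLittleO ?_
    have : (fun t => c - v t) =o[atTop] (fun _ => (1 : ℝ)) := (isLittleO_one_iff ℝ).2 h.phi_lim
    simpa using this.mul_isBigO (isBigO_refl (fun t => c - v t) atTop)
  have hev := ho.bound (show 0 < a / 3 * (b - a) by have := h.ha; positivity)
  obtain ⟨T, hT⟩ := eventually_atTop.1 hev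
  have anti : AntitoneOn (fun t => exp (2 * a / 3 * t) * (b * (c - v t) - deriv v t)) (Ici T) := by
    have hd' : ∀ t, HasDerivAt (fun t => exp (2 * a / 3 * t) * (b * (c - v t) - deriv v t))
      (exp (2 * a / 3 * t) * (rem p c a b v t - a / 3 * (b * (c - v t) - deriv v t))) t :=
        fun t => by
      have := (expd (2 * a / 3) t).mul ((((h.d1 t).const_sub c).const_mul b).sub (h.d2 t))
      refine this.congr_deriv ?_
      simp only [rem, h.ode, Pi.sub_apply]; ring
    refine antitoneOn_of_deriv_nonpos (convex_Ici T)
        (fun t _ => (hd' t).continuousAt.continuousWithinAt)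
        (fun t _ => (hd' t).differentiableAt.differentiableWithinAt) (fun t ht => ?_)
    rw [interior_Ici] at ht
    rw [(hd' t).deriv]
    have h1 := hT t (le_of_lt ht)
    rw [Real.norm_eq_abs, Real.norm_eq_abs, abs_of_pos (h.phi_pos t)] at h1
    have h2 := (le_abs_self _).trans h1
    have h3 := mul_le_mul_of_nonneg_left (h.phi_le_chi t) (show 0 ≤ a / 3 by linarith [h.ha])
    exact mul_nonpos_of_nonneg_of_nonpos (exp_pos _).le (by linarith)
  have hO1 := h.phi_O_of_chi (μ := 2 * a / 3) (T := T) fun t ht => anti (mem_Ici.2 le_rfl) (mem_Ici.2 ht) ht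
  obtain ⟨L, hL, -⟩ := decay_gt (show a < 2 * (2 * a / 3) by linarith [h.ha]) h.chi_d h.rem_nonneg
    (h.rem_O_of_phi hO1)
  exact h.phi_O_of_chi (T := 0) fun t _ => hL t

lemma exp_O {μ ν : ℝ} (hμ : ν ≤ μ) :
    (fun t => exp (-μ * t)) =O[atTop] fun t => exp (-ν * t) := by
  refine IsBigO.of_bound 1 ?_
  filter_upwards [eventually_ge_atTop 0] with t ht
  rw [one_mul, Real.norm_eq_abs, Real.norm_eq_abs, abs_exp, abs_exp]
  exact exp_le_exp.2 (by nlinarith)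

/-- The expansion of `v` and `v'`. -/
lemma expansion (h : Emden p c a b v) : ∃ l, 0 < l ∧ ∀ g, 0 < g → g < min a (b - a) →
    ((fun t => c - v t - l * exp (-a * t)) =O[atTop] fun t => exp (-(a + g) * t)) ∧
    ((fun t => deriv v t - a * l * exp (-a * t)) =O[atTop] fun t => exp (-(a + g) * t)) := by
  have hr := h.rem_O_of_phi h.phi_O
  have hab : 0 < b - a := sub_pos.2 h.hab
  obtain ⟨L, hL, hLO⟩ := decay_gt (show a < 2 * a by linarith [h.ha]) h.chi_d h.rem_nonneg hr
  have hL0 : 0 < L := by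
    have h1 := hL 0
    have h2 := h.phi_le_chi 0
    have := mul_pos hab (h.phi_pos 0)
    simp only [mul_zero, exp_zero, one_mul] at h1
    linarith
  refine ⟨L / (b - a), by positivity, fun g hg hg' => ?_⟩
  have hga := hg'.trans_le (min_le_left _ _)
  have hgb := hg'.trans_le (min_le_right _ _)
  have h1 : (fun t => b * (c - v t) - deriv v t - L * exp (-a * t)) =O[atTop]
      fun t => exp (-(a + g) * t) := hLO.trans (exp_O (by linarith))
  have h2 : (fun t => a * (c - v t) - deriv v t) =O[atTop] fun t => exp (-(a + g) * t) :=
    decay_lt (by linarith) h.psi_d (hr.trans (exp_O (by linarith)))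
  constructor
  · refine ((h1.sub h2).const_mul_left (1 / (b - a))).congr_left fun t => ?_
    field_simp; ring
  · refine (((h1.const_mul_left a).sub (h2.const_mul_left b)).const_mul_left (1 / (b - a))).congr_left fun t => ?_
    field_simp; ring

end Emden

/-- `h` and its first `n` derivatives are `O(e^{-μ t})`. -/
def EC : ℕ → ℝ → (ℝ → ℝ) → Prop
  | 0, μ, h => h =O[atTop] fun t => exp (-μ * t)
  | n + 1, μ, h => (h =O[atTop] fun t => exp (-μ * t)) ∧ EC n μ (deriv h)

lemma EC.zero {n : ℕ} {μ : ℝ} {h : ℝ → ℝ} (H : EC n μ h) : h =O[atTop] fun t => exp (-μ * t) := by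
  cases n with
  | zero => exact H
  | succ n => exact H.1

lemma EC.pred {n : ℕ} {μ : ℝ} {h : ℝ → ℝ} (H : EC (n + 1) μ h) : EC n μ h := by
  induction n generalizing h with
  | zero => exact H.1
  | succ n ih => exact ⟨H.1, ih H.2⟩

lemma EC.weaken {n : ℕ} {μ ν : ℝ} {h : ℝ → ℝ} (hμ : ν ≤ μ) (H : EC n μ h) : EC n ν h := by
  induction n generalizing h with
  | zero => exact IsBigO.trans H (Emden.exp_O hμ)
  | succ n ih => exact ⟨H.1.trans (Emden.exp_O hμ), ih H.2⟩

lemma smooth_deriv {f : ℝ → ℝ} (hf : ContDiff ℝ (⊤ : ℕ∞) f) : ContDiff ℝ (⊤ : ℕ∞) (deriv f) :=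
  (contDiff_infty_iff_deriv.1 hf).2

lemma smooth_diff {f : ℝ → ℝ} (hf : ContDiff ℝ (⊤ : ℕ∞) f) : Differentiable ℝ f :=
  hf.differentiable (by simp)

lemma EC.add {n : ℕ} {μ : ℝ} {f g : ℝ → ℝ} (hf : ContDiff ℝ (⊤ : ℕ∞) f)
    (hg : ContDiff ℝ (⊤ : ℕ∞) g) (F : EC n μ f) (G : EC n μ g) : EC n μ (fun t => f t + g t) := by
  induction n generalizing f g with
  | zero => exact IsBigO.add F G
  | succ n ih =>
    refine ⟨F.1.add G.1, ?_⟩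
    have : deriv (fun t => f t + g t) = fun t => deriv f t + deriv g t :=
      funext fun t => deriv_fun_add (smooth_diff hf t) (smooth_diff hg t)
    rw [this]
    exact ih (smooth_deriv hf) (smooth_deriv hg) F.2 G.2

lemma EC.const_mul {n : ℕ} {μ : ℝ} {f : ℝ → ℝ} (k : ℝ) (hf : ContDiff ℝ (⊤ : ℕ∞) f)
    (F : EC n μ f) : EC n μ (fun t => k * f t) := by
  induction n generalizing f with
  | zero => exact IsBigO.const_mul_left F k
  | succ n ih =>
    refine ⟨F.1.const_mul_left k, ?_⟩
    have : deriv (fun t => k * f t) = fun t => k * deriv f t :=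
      funext fun t => deriv_const_mul k (smooth_diff hf t)
    rw [this]
    exact ih (smooth_deriv hf) F.2

lemma EC.mul {n : ℕ} {μ ν : ℝ} {f g : ℝ → ℝ} (hf : ContDiff ℝ (⊤ : ℕ∞) f)
    (hg : ContDiff ℝ (⊤ : ℕ∞) g) (F : EC n μ f) (G : EC n ν g) :
    EC n (μ + ν) (fun t => f t * g t) := by
  have key : ∀ {f g : ℝ → ℝ}, (f =O[atTop] fun t => exp (-μ * t)) →
      (g =O[atTop] fun t => exp (-ν * t)) →
      (fun t => f t * g t) =O[atTop] fun t => exp (-(μ + ν) * t) := fun F G =>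
    (F.mul G).congr_right fun t => by rw [← exp_add]; ring_nf
  induction n generalizing f g with
  | zero => exact key F G
  | succ n ih =>
    refine ⟨key F.1 G.1, ?_⟩
    have : deriv (fun t => f t * g t) = fun t => deriv f t * g t + f t * deriv g t :=
      funext fun t => deriv_fun_mul (smooth_diff hf t) (smooth_diff hg t)
    rw [this]
    exact EC.add ((smooth_deriv hf).mul hg) (hf.mul (smooth_deriv hg))
      (ih (smooth_deriv hf) hg F.2 G.pred) (ih hf (smooth_deriv hg) F.pred G.2)

namespace Emden
variable {p c a b : ℝ} {v : ℝ → ℝ}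

lemma smooth_rpow (h : Emden p c a b v) (q : ℝ) : ContDiff ℝ (⊤ : ℕ∞) (fun t => v t ^ q) :=
  h.smooth.rpow_const_of_ne fun t => (h.pos t).ne'

lemma deriv_rpow (h : Emden p c a b v) (q : ℝ) :
    deriv (fun t => v t ^ q) = fun t => q * (v t ^ (q - 1) * deriv v t) := by
  funext t
  have := (h.d1 t).rpow_const (p := q) (Or.inl (h.pos t).ne')
  rw [this.deriv]; ring

lemma EC_rpow (h : Emden p c a b v) {n : ℕ} (hv : EC n a (deriv v)) (q : ℝ) :
    EC n 0 (fun t => v t ^ q) := by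
  have key : ∀ q : ℝ, (fun t => v t ^ q) =O[atTop] fun t => exp (-0 * t) := fun q => by
    have h1 : Tendsto (fun t => v t ^ q) atTop (𝓝 (c ^ q)) :=
      h.lim_c.rpow_const (Or.inl h.hc.ne')
    simpa using h1.isBigO_one ℝ
  induction n generalizing q with
  | zero => exact key q
  | succ n ih =>
    refine ⟨key q, ?_⟩
    rw [h.deriv_rpow]
    have := (ih hv.pred (q - 1)).mul (h.smooth_rpow _) h.smooth' hv.pred
    exact EC.const_mul q ((h.smooth_rpow _).mul h.smooth') (this.weaken (by linarith [h.ha]))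

lemma EC_diff (h : Emden p c a b v) {n : ℕ} (hv : EC n a (deriv v)) (q : ℝ) :
    EC n a (fun t => c ^ q - v t ^ q) := by
  have key : (fun t => c ^ q - v t ^ q) =O[atTop] fun t => exp (-a * t) :=
    (h.rpow_diff_O q).trans h.phi_O
  cases n with
  | zero => exact key
  | succ n =>
    refine ⟨key, ?_⟩
    have : deriv (fun t => c ^ q - v t ^ q) = fun t => (-q) * (v t ^ (q - 1) * deriv v t) := by
      funext t
      rw [deriv_const_sub, h.deriv_rpow]; ring
    rw [this]
    have := (h.EC_rpow hv.pred (q - 1)).mul (h.smooth_rpow _) h.smooth' hv.pred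
    rw [zero_add] at this
    exact EC.const_mul _ ((h.smooth_rpow _).mul h.smooth') this

lemma EC_rem (h : Emden p c a b v) {n : ℕ} (hv : EC n a (deriv v)) :
    EC n (2 * a) (rem p c a b v) := by
  have key := h.rem_O_of_phi h.phi_O
  cases n with
  | zero => exact key
  | succ n =>
    refine ⟨key, ?_⟩
    have : deriv (rem p c a b v) =
        fun t => (-p) * ((c ^ (p - 1) - v t ^ (p - 1)) * deriv v t) := by
      funext t
      have h1 := (((h.d1 t).const_sub c).const_mul (a * b)).sub
        (((h.d1 t).const_mul (c ^ (p - 1))).sub ((h.d1 t).rpow_const (p := p) (Or.inl (h.pos t).ne')))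
      refine (h1.deriv.symm.trans rfl).symm.trans ?_
      rw [h.hB]; ring
    rw [this]
    have := (h.EC_diff hv.pred (p - 1)).mul (contDiff_const.sub (h.smooth_rpow _)) h.smooth' hv.pred
    rw [← two_mul] at this
    exact EC.const_mul _ ((contDiff_const.sub (h.smooth_rpow _)).mul h.smooth') this

lemma smooth_rem (h : Emden p c a b v) : ContDiff ℝ (⊤ : ℕ∞) (rem p c a b v) := by
  unfold rem
  exact (contDiff_const.mul (contDiff_const.sub h.smooth)).sub
    ((contDiff_const.mul h.smooth).sub (h.smooth_rpow _))

lemma dv_O (h : Emden p c a b v) : deriv v =O[atTop] fun t => exp (-a * t) := by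
  refine IsBigO.trans (IsBigO.of_bound a (Eventually.of_forall fun t => ?_)) h.phi_O
  rw [Real.norm_eq_abs, Real.norm_eq_abs, abs_of_pos (h.v'_pos t), abs_of_pos (h.phi_pos t)]
  linarith [h.psi_nonneg t]

lemma ddv (h : Emden p c a b v) : deriv (deriv v) =
    fun t => (-(a + b)) * deriv v t + (a * b * (c - v t) + (-1) * rem p c a b v t) := by
  funext t
  rw [h.ode]; unfold rem; ring

lemma EC_all (h : Emden p c a b v) (n : ℕ) : EC n a (fun t => c - v t) ∧ EC n a (deriv v) := by
  have sphi : ContDiff ℝ (⊤ : ℕ∞) (fun t => c - v t) := contDiff_const.sub h.smooth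
  induction n with
  | zero => exact ⟨h.phi_O, h.dv_O⟩
  | succ n ih =>
    constructor
    · refine ⟨h.phi_O, ?_⟩
      have : deriv (fun t => c - v t) = fun t => (-1) * deriv v t := by
        funext t; rw [deriv_const_sub]; ring
      rw [this]
      exact EC.const_mul _ h.smooth' ih.2
    · refine ⟨h.dv_O, ?_⟩
      rw [h.ddv]
      exact EC.add (contDiff_const.mul h.smooth')
        ((contDiff_const.mul sphi).add (contDiff_const.mul h.smooth_rem))
        (EC.const_mul _ h.smooth' ih.2)
        (EC.add (contDiff_const.mul sphi) (contDiff_const.mul h.smooth_rem)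
          (EC.const_mul _ sphi ih.1)
          (EC.const_mul _ h.smooth_rem ((h.EC_rem ih.2).weaken (by linarith [h.ha]))))

lemma smooth_exp (k l : ℝ) : ContDiff ℝ (⊤ : ℕ∞) (fun t => l * exp (k * t)) :=
  contDiff_const.mul (contDiff_exp.comp (contDiff_const.mul contDiff_id))

/-- Full expansion with all derivatives. -/
lemma expansion_all (h : Emden p c a b v) : ∃ l, 0 < l ∧ ∀ g, 0 < g → g < min a (b - a) →
    ∀ n, EC n (a + g) (fun t => c - v t - l * exp (-a * t)) ∧
      EC n (a + g) (fun t => deriv v t - a * l * exp (-a * t)) := by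
  obtain ⟨l, hl, H⟩ := h.expansion
  refine ⟨l, hl, fun g hg hg' n => ?_⟩
  obtain ⟨H1, H2⟩ := H g hg hg'
  have s1 : ContDiff ℝ (⊤ : ℕ∞) (fun t => c - v t - l * exp (-a * t)) :=
    (contDiff_const.sub h.smooth).sub (smooth_exp _ _)
  have s2 : ContDiff ℝ (⊤ : ℕ∞) (fun t => deriv v t - a * l * exp (-a * t)) :=
    h.smooth'.sub (smooth_exp _ _)
  induction n with
  | zero => exact ⟨H1, H2⟩
  | succ n ih =>
    constructor
    · refine ⟨H1, ?_⟩
      have : deriv (fun t => c - v t - l * exp (-a * t)) =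
          fun t => (-1) * (deriv v t - a * l * exp (-a * t)) := by
        funext t
        refine (((h.d1 t).const_sub c).sub ((expd (-a) t).const_mul l)).deriv.trans ?_
        ring
      rw [this]
      exact EC.const_mul _ s2 ih.2
    · refine ⟨H2, ?_⟩
      have : deriv (fun t => deriv v t - a * l * exp (-a * t)) =
          fun t => (-(a + b)) * (deriv v t - a * l * exp (-a * t)) +
            (a * b * (c - v t - l * exp (-a * t)) + (-1) * rem p c a b v t) := by
        funext t
        refine ((h.d2 t).sub ((expd (-a) t).const_mul (a * l))).deriv.trans ?_
        rw [h.ddv]; ring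
      rw [this]
      refine EC.add (contDiff_const.mul s2)
        ((contDiff_const.mul s1).add (contDiff_const.mul h.smooth_rem))
        (EC.const_mul _ s2 ih.2)
        (EC.add (contDiff_const.mul s1) (contDiff_const.mul h.smooth_rem)
          (EC.const_mul _ s1 ih.1)
          (EC.const_mul _ h.smooth_rem ((h.EC_rem (h.EC_all n).2).weaken ?_)))
      linarith [hg'.trans_le (min_le_left _ _)]

end Emden

/-- Transfer to the original variable. -/
lemma transfer {μ : ℝ} (k : ℕ) : ∀ (s : ℝ) (h F : ℝ → ℝ), ContDiff ℝ (⊤ : ℕ∞) h → EC k μ h →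
    (∀ y, 0 < y → F y = y ^ s * h (log y)) →
    iteratedDeriv k F =O[atTop] fun y : ℝ => y ^ (s - μ - (k : ℝ)) := by
  induction k with
  | zero =>
    intro s h F hh H hF
    have h1 := (H.zero.comp_tendsto Real.tendsto_log_atTop)
    have h2 := (isBigO_refl (fun y : ℝ => y ^ s) atTop).mul h1
    rw [iteratedDeriv_zero]
    refine h2.congr' ?_ ?_
    · filter_upwards [eventually_gt_atTop 0] with y hy using (hF y hy).symm
    · filter_upwards [eventually_gt_atTop 0] with y hy
      simp only [Function.comp]
      rw [show -μ * log y = log y * (-μ) by ring, ← Real.rpow_def_of_pos hy, ← Real.rpow_add hy]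
      simp [sub_eq_add_neg]
  | succ k ih =>
    intro s h F hh H hF
    rw [iteratedDeriv_succ']
    have := ih (s - 1) (fun t => s * h t + deriv h t) (deriv F)
      ((contDiff_const.mul hh).add (smooth_deriv hh))
      (EC.add (contDiff_const.mul hh) (smooth_deriv hh) (EC.const_mul s hh H.pred) H.2) ?_
    · refine this.congr_right fun y => ?_
      push_cast; ring_nf
    · intro y hy
      have e : F =ᶠ[𝓝 y] fun y => y ^ s * h (log y) := by
        filter_upwards [lt_mem_nhds hy] with z hz using hF z hz
      rw [e.deriv_eq]
      have h1 := (Real.hasDerivAt_rpow_const (x := y) (p := s) (Or.inl hy.ne')).mul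
        (HasDerivAt.comp y ((smooth_diff hh) (log y)).hasDerivAt (Real.hasDerivAt_log hy.ne'))
      refine h1.deriv.trans ?_
      simp only [Function.comp]
      have : y ^ s = y ^ (s - 1) * y := by rw [rpow_pred_mul hy]
      rw [this]; field_simp

/-- Arithmetic consequences of `p > p_JL`, with `m = 2/(p-1)`. -/
lemma consts (d : ℕ) (hd : 11 ≤ d) (p : ℝ) (hp1 : 1 < p) (hp : pJL d < p) :
    0 < 2 / (p - 1) ∧ 0 < (d : ℝ) - 2 - 2 * (2 / (p - 1)) ∧
    cInfty d p ^ (p - 1) = (2 / (p - 1)) * ((d : ℝ) - 2 - 2 / (p - 1)) ∧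
    0 < cInfty d p ∧ 0 < discr d p ∧ 0 < alph d p ∧ alph d p < alph₂ d p ∧
    alph d p + alph₂ d p = (d : ℝ) - 2 - 2 * (2 / (p - 1)) ∧
    alph d p * alph₂ d p = (p - 1) * cInfty d p ^ (p - 1) := by
  have hd' : (11 : ℝ) ≤ d := by exact_mod_cast hd
  set s := Real.sqrt ((d : ℝ) - 1) with hs
  have hs2 : s * s = d - 1 := Real.mul_self_sqrt (by linarith)
  have hs0 : 0 ≤ s := Real.sqrt_nonneg _
  have hD : 0 < (d : ℝ) - 4 - 2 * s := by
    by_contra hcon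
    push Not at hcon
    nlinarith
  have hq : 0 < p - 1 := by linarith
  unfold pJL at hp
  rw [← hs] at hp
  have hp4 : 4 / ((d : ℝ) - 4 - 2 * s) < p - 1 := by linarith
  rw [div_lt_iff₀ hD] at hp4
  set m := 2 / (p - 1) with hm
  have hm0 : 0 < m := by positivity
  have hmq : m * (p - 1) = 2 := by rw [hm]; field_simp
  have hm4 : 4 / (p - 1) = 2 * m := by rw [hm]; ring
  have hmD : 2 * m < (d : ℝ) - 4 - 2 * s := by
    have : (p - 1) * (2 * m) < (p - 1) * ((d : ℝ) - 4 - 2 * s) := by nlinarith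
    exact lt_of_mul_lt_mul_left this hq.le
  have hA : 0 < (d : ℝ) - 2 - 2 * m := by linarith
  have hcpos : 0 < m * ((d : ℝ) - 2 - m) := mul_pos hm0 (by linarith)
  have hc : cInfty d p ^ (p - 1) = m * ((d : ℝ) - 2 - m) := by
    unfold cInfty
    rw [← Real.rpow_mul hcpos.le, one_div, inv_mul_cancel₀ hq.ne', Real.rpow_one]
  have hc0 : 0 < cInfty d p := Real.rpow_pos_of_pos hcpos _
  have hdis : discr d p = ((d : ℝ) - 2 - 2 * m) ^ 2 - 8 * ((d : ℝ) - 2 - m) := by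
    unfold discr
    rw [hc]
    linear_combination (-4 * ((d : ℝ) - 2 - m)) * hmq
  have hdis0 : 0 < discr d p := by
    rw [hdis]; nlinarith
  set r := Real.sqrt (discr d p) with hr
  have hr0 : 0 < r := Real.sqrt_pos.2 hdis0
  have hr2 : r * r = discr d p := Real.mul_self_sqrt hdis0.le
  have ha : alph d p = ((d : ℝ) - 2 - 2 * m - r) / 2 := by
    unfold alph gam; rw [← hr]; ring
  have hb : alph₂ d p = ((d : ℝ) - 2 - 2 * m + r) / 2 := by
    unfold alph₂; rw [ha, hm4]; ring
  refine ⟨hm0, hA, hc, hc0, hdis0, ?_, ?_, ?_, ?_⟩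
  · rw [ha]
    have : r < (d : ℝ) - 2 - 2 * m := by
      by_contra hcon
      push Not at hcon
      nlinarith
    linarith
  · rw [ha, hb]; linarith
  · rw [ha, hb]; ring
  · rw [ha, hb, hc]
    rw [hdis] at hr2
    linear_combination (-1 / 4) * hr2 - ((d : ℝ) - 2 - m) * hmq

/-- The Emden–Fowler transform. -/
def vfun (p : ℝ) (Q : ℝ → ℝ) : ℝ → ℝ := fun t => exp (2 / (p - 1) * t) * Q (exp t)

lemma vfun_deriv {p : ℝ} {Q : ℝ → ℝ} (hQ : ContDiff ℝ (⊤ : ℕ∞) Q) :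
    deriv (vfun p Q) = fun t => exp (2 / (p - 1) * t) * Lam1 p Q (exp t) := by
  funext t
  have h1 := (Emden.expd (2 / (p - 1)) t).mul
    (HasDerivAt.comp t ((smooth_diff hQ) (exp t)).hasDerivAt (Real.hasDerivAt_exp t))
  refine h1.deriv.trans ?_
  simp only [Lam1, Function.comp]; ring

lemma emden_of (d : ℕ) (hd : 11 ≤ d) (p : ℝ) (hp1 : 1 < p)
    (hp : pJL d < p) (Q : ℝ → ℝ) (hQ : IsGroundState d p Q) :
    Emden p (cInfty d p) (alph d p) (alph₂ d p) (vfun p Q) := by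
  obtain ⟨hm0, hA, hc, hc0, hdis0, ha, hab, hsum, hprod⟩ := consts d hd p hp1 hp
  have hLs : ContDiff ℝ (⊤ : ℕ∞) (Lam1 p Q) :=
    (contDiff_const.mul hQ.smooth).add (contDiff_id.mul (smooth_deriv hQ.smooth))
  refine ⟨hp1, hc0, ha, hab, hprod, ?_, ?_, ?_, ?_, ?_⟩
  · exact (contDiff_exp.comp (contDiff_const.mul contDiff_id)).mul (hQ.smooth.comp contDiff_exp)
  · intro t
    exact mul_pos (exp_pos _) (hQ.pos _ (exp_pos t).le)
  · intro t
    rw [hsum, hc, vfun_deriv hQ.smooth]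
    have h1 := (Emden.expd (2 / (p - 1)) t).mul
      (HasDerivAt.comp t ((smooth_diff hLs) (exp t)).hasDerivAt (Real.hasDerivAt_exp t))
    refine h1.deriv.trans ?_
    have h2 : deriv (Lam1 p Q) (exp t) = 2 / (p - 1) * deriv Q (exp t) +
        (deriv Q (exp t) + exp t * deriv (deriv Q) (exp t)) := by
      have := ((smooth_diff hQ.smooth (exp t)).hasDerivAt.const_mul (2 / (p - 1))).add
        ((hasDerivAt_id (exp t)).mul (smooth_diff (smooth_deriv hQ.smooth) (exp t)).hasDerivAt)
      refine this.deriv.trans ?_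
      simp
    have h3 := hQ.ode (exp t) (exp_pos t)
    have h4 : vfun p Q t ^ p = exp (2 / (p - 1) * t) * (exp t * exp t) * Q (exp t) ^ p := by
      unfold vfun
      rw [Real.mul_rpow (exp_pos _).le (hQ.pos _ (exp_pos t).le).le, ← Real.exp_mul,
        ← exp_add, ← exp_add]
      congr 2
      have : p - 1 ≠ 0 := by linarith
      field_simp
      ring
    rw [h4]
    simp only [Function.comp, h2, vfun, Lam1]
    set m := 2 / (p - 1)
    set y := exp t with hy
    have hy0 : 0 < y := exp_pos t
    have h5 : y * y * deriv (deriv Q) y = -((d : ℝ) - 1) * y * deriv Q y - y * y * Q y ^ p := by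
      field_simp at h3
      linear_combination y * h3
    linear_combination (exp (m * t)) * h5
  · have h1 := (Emden.exp_bot hm0).mul
      ((hQ.smooth.continuous.tendsto 0).comp Real.tendsto_exp_atBot)
    rw [zero_mul] at h1
    exact h1
  · rw [vfun_deriv hQ.smooth]
    have h1 := (Emden.exp_bot hm0).mul
      ((hLs.continuous.tendsto 0).comp Real.tendsto_exp_atBot)
    simpa [Function.comp_def] using h1

lemma Q_eq {p : ℝ} {Q : ℝ → ℝ} {y : ℝ} (hy : 0 < y) :
    Q y = y ^ (-(2 / (p - 1))) * vfun p Q (log y) := by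
  unfold vfun
  rw [exp_log hy, ← mul_assoc, show 2 / (p - 1) * log y = log y * (2 / (p - 1)) by ring,
    ← Real.rpow_def_of_pos hy, ← Real.rpow_add hy]
  simp

lemma Lam_eq {p : ℝ} {Q : ℝ → ℝ} (hQ : ContDiff ℝ (⊤ : ℕ∞) Q) {y : ℝ} (hy : 0 < y) :
    Lam1 p Q y = y ^ (-(2 / (p - 1))) * deriv (vfun p Q) (log y) := by
  rw [vfun_deriv hQ]
  simp only
  rw [exp_log hy, ← mul_assoc, show 2 / (p - 1) * log y = log y * (2 / (p - 1)) by ring,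
    ← Real.rpow_def_of_pos hy, ← Real.rpow_add hy]
  simp

lemma iter_sub_O {F G : ℝ → ℝ} {w : ℝ → ℝ} (k : ℕ) (hF : ContDiff ℝ (⊤ : ℕ∞) F)
    (hG : ∀ y, 0 < y → ContDiffAt ℝ k G y)
    (H : iteratedDeriv k (fun y => F y - G y) =O[atTop] w) :
    (fun y => iteratedDeriv k F y - iteratedDeriv k G y) =O[atTop] w := by
  refine H.congr' ?_ EventuallyEq.rfl
  filter_upwards [eventually_gt_atTop 0] with y hy
  have hF' : ContDiffAt ℝ k F y := (hF.of_le (by exact_mod_cast le_top)).contDiffAt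
  exact iteratedDeriv_fun_sub hF' (hG y hy)

lemma pow_exp {m γ y : ℝ} (hy : 0 < y) : y ^ (-γ) = y ^ (-m) * exp (-(γ - m) * log y) := by
  rw [show -(γ - m) * log y = log y * (m - γ) by ring, ← Real.rpow_def_of_pos hy,
    ← Real.rpow_add hy]
  congr 1; ring

lemma cdp (k : ℕ) (K s : ℝ) {y : ℝ} (hy : 0 < y) :
    ContDiffAt ℝ k (fun z : ℝ => K * z ^ s) y :=
  contDiffAt_const.mul (Real.contDiffAt_rpow_const_of_ne hy.ne')

lemma parts_12 (d : ℕ) (hd : 11 ≤ d) (p : ℝ) (hp1 : 1 < p)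
    (hp : pJL d < p) (Q : ℝ → ℝ) (hQ : IsGroundState d p Q) :
    ∃ a₁ c : ℝ, a₁ ≠ 0 ∧ c ≠ 0 ∧
      (∀ g : ℝ, 0 < g → g < min (alph d p) (alph₂ d p - alph d p) → ∀ k : ℕ,
        ((fun y : ℝ => iteratedDeriv k Q y -
            iteratedDeriv k
              (fun z : ℝ => cInfty d p * z ^ (-(2 / (p - 1))) + a₁ * z ^ (-(gam d p))) y)
          =O[atTop] fun y : ℝ => y ^ (-(gam d p) - g - (k : ℝ))) ∧
        ((fun y : ℝ => iteratedDeriv k (Lam1 p Q) y -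
            iteratedDeriv k (fun z : ℝ => c * z ^ (-(gam d p))) y)
          =O[atTop] fun y : ℝ => y ^ (-(gam d p) - g - (k : ℝ)))) := by
  have E := emden_of d hd p hp1 hp Q hQ
  obtain ⟨l, hl, H⟩ := E.expansion_all
  have hLs : ContDiff ℝ (⊤ : ℕ∞) (Lam1 p Q) :=
    (contDiff_const.mul hQ.smooth).add (contDiff_id.mul (smooth_deriv hQ.smooth))
  refine ⟨-l, alph d p * l, by simp [hl.ne'], mul_ne_zero E.ha.ne' hl.ne', fun g hg hg' k => ?_⟩
  obtain ⟨H1, H2⟩ := H g hg hg' k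
  have s1 : ContDiff ℝ (⊤ : ℕ∞)
      (fun t => cInfty d p - vfun p Q t - l * exp (-(alph d p) * t)) :=
    (contDiff_const.sub E.smooth).sub (Emden.smooth_exp _ _)
  have s2 : ContDiff ℝ (⊤ : ℕ∞)
      (fun t => deriv (vfun p Q) t - alph d p * l * exp (-(alph d p) * t)) :=
    E.smooth'.sub (Emden.smooth_exp _ _)
  have ew : ∀ y : ℝ, y ^ (-(2 / (p - 1)) - (alph d p + g) - (k : ℝ)) =
      y ^ (-(gam d p) - g - (k : ℝ)) := fun y => by
    congr 1; unfold alph; ring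
  have eg : ∀ {y : ℝ}, 0 < y → y ^ (-(gam d p)) =
      y ^ (-(2 / (p - 1))) * exp (-(alph d p) * log y) := fun hy => pow_exp hy
  constructor
  · refine iter_sub_O k hQ.smooth (fun y hy => (cdp k _ _ hy).add (cdp k _ _ hy)) ?_
    refine (transfer k (-(2 / (p - 1))) _ _ (contDiff_const.mul s1)
      (EC.const_mul (-1) s1 H1) fun y hy => ?_).congr_right ew
    rw [eg hy, Q_eq (p := p) (Q := Q) hy]; ring
  · refine iter_sub_O k hLs (fun y hy => cdp k _ _ hy) ?_
    refine (transfer k (-(2 / (p - 1))) _ _ s2 H2 fun y hy => ?_).congr_right ew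
    rw [eg hy, Lam_eq hQ.smooth hy]; ring

lemma part_4 (d : ℕ) (hd : 11 ≤ d) (p : ℝ) (hp1 : 1 < p)
    (hp : pJL d < p) (Q : ℝ → ℝ) (hQ : IsGroundState d p Q) (y : ℝ) (hy : 0 ≤ y) :
    0 < Lam1 p Q y := by
  have E := emden_of d hd p hp1 hp Q hQ
  rcases hy.eq_or_lt with rfl | hy
  · simp only [Lam1, hQ.at0]
    have : 0 < p - 1 := by linarith
    simpa using this
  · rw [Lam_eq hQ.smooth hy]
    exact mul_pos (Real.rpow_pos_of_pos hy _) (E.v'_pos _)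

lemma Q_pow_le (d : ℕ) (hd : 11 ≤ d) (p : ℝ) (hp1 : 1 < p)
    (hp : pJL d < p) (Q : ℝ → ℝ) (hQ : IsGroundState d p Q) (y : ℝ) (hy : 0 < y) :
    Q y ^ (p - 1) ≤ cInfty d p ^ (p - 1) / y ^ 2 := by
  have E := emden_of d hd p hp1 hp Q hQ
  rw [Q_eq (p := p) (Q := Q) hy, Real.mul_rpow (Real.rpow_pos_of_pos hy _).le (E.pos _).le,
    ← Real.rpow_mul hy.le]
  have hq : p - 1 ≠ 0 := by linarith
  rw [show -(2 / (p - 1)) * (p - 1) = -(2 : ℕ) by push_cast; field_simp,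
    Real.rpow_neg hy.le, Real.rpow_natCast, mul_comm, ← div_eq_mul_inv]
  gcongr
  · exact (E.pos _).le
  · linarith [E.phi_pos (log y)]

section Hardy
variable {d : ℕ} {u : EuclideanSpace ℝ (Fin d) → ℝ}

lemma reg_bound {ε X : ℝ} (hε : 0 < ε) :
    X * (X ^ 2 + ε)⁻¹ ≤ 1 + ε⁻¹ := by
  have h1 : 0 < X ^ 2 + ε := by positivity
  rw [← div_eq_mul_inv, div_le_iff₀ h1]
  have : ε⁻¹ * ε = 1 := inv_mul_cancel₀ hε.ne'
  have h2 : 0 < ε⁻¹ := by positivity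
  nlinarith [sq_nonneg (X - 1), mul_nonneg h2.le (sq_nonneg X)]

lemma reg_inv_le {ε X : ℝ} (hε : 0 < ε) : (X ^ 2 + ε)⁻¹ ≤ ε⁻¹ :=
  inv_anti₀ hε (by nlinarith [sq_nonneg X])

lemma reg_sq {ε X : ℝ} (hε : 0 < ε) : X ^ 2 * (X ^ 2 + ε)⁻¹ ≤ 1 := by
  have h1 : 0 < X ^ 2 + ε := by positivity
  rw [← div_eq_mul_inv, div_le_one h1]; linarith

lemma line_g (ε : ℝ) (hε : 0 < ε) (i : Fin d) (x : EuclideanSpace ℝ (Fin d)) :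
    HasLineDerivAt ℝ (fun x : EuclideanSpace ℝ (Fin d) => x i * (‖x‖ ^ 2 + ε)⁻¹)
      ((‖x‖ ^ 2 + ε)⁻¹ - 2 * x i ^ 2 * ((‖x‖ ^ 2 + ε)⁻¹) ^ 2) x (EuclideanSpace.single i 1) := by
  unfold HasLineDerivAt
  have h0 : HasDerivAt (fun t : ℝ => x + t • EuclideanSpace.single i (1 : ℝ))
      (EuclideanSpace.single i (1 : ℝ)) 0 := by
    simpa using ((hasDerivAt_id (0 : ℝ)).smul_const (EuclideanSpace.single i (1 : ℝ))).const_add x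
  have h1 : HasDerivAt (fun t : ℝ => (x + t • EuclideanSpace.single i (1 : ℝ)) i) 1 0 := by
    simpa using (hasDerivAt_id (0 : ℝ)).const_add (x i)
  have h2 := (h0.norm_sq.add_const ε).inv (by simp; positivity)
  have h3 := h1.mul h2
  refine h3.congr_deriv ?_
  simp [EuclideanSpace.inner_single_right]
  ring

lemma hardy_ibp (hu : Differentiable ℝ u) (h2 : MemLp u 2 volume)
    (hD : MemLp (fun x => fderiv ℝ u x) 2 volume) {ε : ℝ} (hε : 0 < ε) :
    Integrable (fun x : EuclideanSpace ℝ (Fin d) =>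
      2 * u x * fderiv ℝ u x x * (‖x‖ ^ 2 + ε)⁻¹) ∧
    Integrable (fun x : EuclideanSpace ℝ (Fin d) =>
      u x ^ 2 * (d * (‖x‖ ^ 2 + ε)⁻¹ - 2 * ‖x‖ ^ 2 * ((‖x‖ ^ 2 + ε)⁻¹) ^ 2)) ∧
    ∫ x : EuclideanSpace ℝ (Fin d),
      u x ^ 2 * (d * (‖x‖ ^ 2 + ε)⁻¹ - 2 * ‖x‖ ^ 2 * ((‖x‖ ^ 2 + ε)⁻¹) ^ 2) =
    - ∫ x : EuclideanSpace ℝ (Fin d), 2 * u x * fderiv ℝ u x x * (‖x‖ ^ 2 + ε)⁻¹ := by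
  have iu : Integrable (fun x => u x ^ 2) := h2.integrable_sq
  have iD : Integrable (fun x => ‖fderiv ℝ u x‖ ^ 2) := hD.norm.integrable_sq
  have uc := hu.continuous
  have wpos : ∀ x : EuclideanSpace ℝ (Fin d), 0 < ‖x‖ ^ 2 + ε := fun x => by positivity
  have wc : Continuous (fun x : EuclideanSpace ℝ (Fin d) => (‖x‖ ^ 2 + ε)⁻¹) :=
    ((continuous_norm.pow 2).add continuous_const).inv₀ fun x => (wpos x).ne'
  have cc : ∀ i : Fin d, Continuous (fun x : EuclideanSpace ℝ (Fin d) => x i) := fun i => by fun_prop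
  have xi : ∀ (i : Fin d) (x : EuclideanSpace ℝ (Fin d)), |x i| ≤ ‖x‖ := fun i x =>
    PiLp.norm_apply_le x i
  set e : Fin d → EuclideanSpace ℝ (Fin d) := fun i => EuclideanSpace.single i 1 with he
  have gb : ∀ (i : Fin d) (x : EuclideanSpace ℝ (Fin d)),
      |x i * (‖x‖ ^ 2 + ε)⁻¹| ≤ 1 + ε⁻¹ := fun i x => by
    have hw : 0 < (‖x‖ ^ 2 + ε)⁻¹ := inv_pos.2 (wpos x)
    rw [abs_mul, abs_of_pos hw]
    exact (mul_le_mul_of_nonneg_right (xi i x) hw.le).trans (reg_bound hε)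
  have main : ∀ i : Fin d,
      Integrable (fun x => (2 * u x * fderiv ℝ u x (e i)) * (x i * (‖x‖ ^ 2 + ε)⁻¹)) ∧
      Integrable (fun x => u x ^ 2 * ((‖x‖ ^ 2 + ε)⁻¹ - 2 * x i ^ 2 * ((‖x‖ ^ 2 + ε)⁻¹) ^ 2)) ∧
      ∫ x, u x ^ 2 * ((‖x‖ ^ 2 + ε)⁻¹ - 2 * x i ^ 2 * ((‖x‖ ^ 2 + ε)⁻¹) ^ 2) =
      - ∫ x, (2 * u x * fderiv ℝ u x (e i)) * (x i * (‖x‖ ^ 2 + ε)⁻¹) := by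
    intro i
    have I1 : Integrable (fun x => (2 * u x * fderiv ℝ u x (e i)) * (x i * (‖x‖ ^ 2 + ε)⁻¹)) := by
      refine ((iu.add iD).mul_const (1 + ε⁻¹)).mono' ?_ (Eventually.of_forall fun x => ?_)
      · refine Measurable.aestronglyMeasurable ?_
        exact ((uc.measurable.const_mul 2).mul (measurable_fderiv_apply_const ℝ u (e i))).mul
          ((cc i).mul wc).measurable
      · rw [norm_mul, Real.norm_eq_abs, Real.norm_eq_abs]
        have h1 : |2 * u x * fderiv ℝ u x (e i)| ≤ u x ^ 2 + ‖fderiv ℝ u x‖ ^ 2 := by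
          have h3 : |fderiv ℝ u x (e i)| ≤ ‖fderiv ℝ u x‖ := by
            have := (fderiv ℝ u x).le_opNorm (e i)
            simpa [he] using this
          rw [abs_mul, abs_mul, abs_two]
          have := mul_le_mul_of_nonneg_left h3 (abs_nonneg (u x))
          nlinarith [sq_nonneg (|u x| - ‖fderiv ℝ u x‖), sq_abs (u x)]
        exact mul_le_mul h1 (gb i x) (abs_nonneg _) (add_nonneg (sq_nonneg _) (sq_nonneg _))
    have I2 : Integrable (fun x => u x ^ 2 *
        ((‖x‖ ^ 2 + ε)⁻¹ - 2 * x i ^ 2 * ((‖x‖ ^ 2 + ε)⁻¹) ^ 2)) := by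
      refine (iu.mul_const (3 * ε⁻¹)).mono' ?_ (Eventually.of_forall fun x => ?_)
      · exact ((uc.pow 2).mul (wc.sub ((continuous_const.mul ((cc i).pow 2)).mul
          (wc.pow 2)))).aestronglyMeasurable
      · rw [norm_mul, Real.norm_eq_abs, Real.norm_eq_abs, abs_of_nonneg (sq_nonneg (u x))]
        refine mul_le_mul_of_nonneg_left ?_ (sq_nonneg _)
        have hw : 0 < (‖x‖ ^ 2 + ε)⁻¹ := inv_pos.2 (wpos x)
        have hw2 := reg_inv_le (X := ‖x‖) hε
        have hw3 := reg_sq (X := ‖x‖) hε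
        have hx2 : x i ^ 2 ≤ ‖x‖ ^ 2 := sq_le_sq.2 (by simpa using xi i x)
        set w := (‖x‖ ^ 2 + ε)⁻¹
        have h4 : x i ^ 2 * w ≤ 1 := (mul_le_mul_of_nonneg_right hx2 hw.le).trans hw3
        have h5 : x i ^ 2 * w ^ 2 ≤ w := by nlinarith
        have h6 : 0 ≤ x i ^ 2 * w ^ 2 := by positivity
        rw [abs_le]; constructor <;> linarith
    have I3 : Integrable (fun x => u x ^ 2 * (x i * (‖x‖ ^ 2 + ε)⁻¹)) := by
      refine (iu.mul_const (1 + ε⁻¹)).mono' ?_ (Eventually.of_forall fun x => ?_)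
      · exact ((uc.pow 2).mul ((cc i).mul wc)).aestronglyMeasurable
      · rw [norm_mul, Real.norm_eq_abs, Real.norm_eq_abs, abs_of_nonneg (sq_nonneg (u x))]
        exact mul_le_mul_of_nonneg_left (gb i x) (sq_nonneg _)
    refine ⟨I1, I2, ?_⟩
    refine integral_bilinear_hasLineDerivAt_right_eq_neg_left_of_integrable
      (B := ContinuousLinearMap.mul ℝ ℝ) (f := fun x => u x ^ 2)
      (f' := fun x => 2 * u x * fderiv ℝ u x (e i))
      (g := fun x => x i * (‖x‖ ^ 2 + ε)⁻¹) (v := e i) I1 I2 I3 (fun x _ => ?_)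
      (fun x _ => line_g ε hε i x)
    have := ((hu x).hasFDerivAt.pow 2).hasLineDerivAt (e i)
    simpa using this
  have S1 : ∀ x : EuclideanSpace ℝ (Fin d), 2 * u x * fderiv ℝ u x x * (‖x‖ ^ 2 + ε)⁻¹ =
      ∑ i, (2 * u x * fderiv ℝ u x (e i)) * (x i * (‖x‖ ^ 2 + ε)⁻¹) := fun x => by
    have hx : fderiv ℝ u x x = ∑ i, x i * fderiv ℝ u x (e i) := by
      have h1 : x = ∑ i, x i • e i := by
        ext j
        simp [he, Pi.single_apply]
      conv_lhs => rw [h1]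
      rw [map_sum]
      simp only [map_smul, smul_eq_mul]
      rw [← h1]
    rw [hx, Finset.mul_sum, Finset.sum_mul]
    exact Finset.sum_congr rfl fun i _ => by ring
  have S2 : ∀ x : EuclideanSpace ℝ (Fin d),
      u x ^ 2 * (d * (‖x‖ ^ 2 + ε)⁻¹ - 2 * ‖x‖ ^ 2 * ((‖x‖ ^ 2 + ε)⁻¹) ^ 2) =
      ∑ i, u x ^ 2 * ((‖x‖ ^ 2 + ε)⁻¹ - 2 * x i ^ 2 * ((‖x‖ ^ 2 + ε)⁻¹) ^ 2) := fun x => by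
    rw [← Finset.mul_sum, Finset.sum_sub_distrib, ← Finset.sum_mul, ← Finset.mul_sum]
    have : ∑ i, x i ^ 2 = ‖x‖ ^ 2 := (EuclideanSpace.real_norm_sq_eq x).symm
    rw [this]; simp
  simp only [S1, S2]
  refine ⟨integrable_finsetSum _ fun i _ => (main i).1,
    integrable_finsetSum _ fun i _ => (main i).2.1, ?_⟩
  rw [integral_finsetSum _ fun i _ => (main i).1, integral_finsetSum _ fun i _ => (main i).2.1,
    ← Finset.sum_neg_distrib]
  exact Finset.sum_congr rfl fun i _ => (main i).2.2

lemma hardy_reg (hd : 2 ≤ d) (hu : Differentiable ℝ u) (h2 : MemLp u 2 volume)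
    (hD : MemLp (fun x => fderiv ℝ u x) 2 volume) {ε : ℝ} (hε : 0 < ε) :
    Integrable (fun x : EuclideanSpace ℝ (Fin d) => u x ^ 2 * (‖x‖ ^ 2 + ε)⁻¹) ∧
    ((d : ℝ) - 2) ^ 2 / 4 * ∫ x : EuclideanSpace ℝ (Fin d), u x ^ 2 * (‖x‖ ^ 2 + ε)⁻¹ ≤
      ∫ x : EuclideanSpace ℝ (Fin d), ‖fderiv ℝ u x‖ ^ 2 := by
  have iu : Integrable (fun x => u x ^ 2) := h2.integrable_sq
  have iD : Integrable (fun x => ‖fderiv ℝ u x‖ ^ 2) := hD.norm.integrable_sq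
  obtain ⟨I1, I2, I3⟩ := hardy_ibp hu h2 hD hε
  have hN : (0 : ℝ) ≤ (d : ℝ) - 2 := by
    have : (2 : ℝ) ≤ d := by exact_mod_cast hd
    linarith
  have wpos : ∀ x : EuclideanSpace ℝ (Fin d), 0 < ‖x‖ ^ 2 + ε := fun x => by positivity
  have I4 : Integrable (fun x : EuclideanSpace ℝ (Fin d) => u x ^ 2 * (‖x‖ ^ 2 + ε)⁻¹) := by
    refine (iu.mul_const ε⁻¹).mono' ?_ (Eventually.of_forall fun x => ?_)
    · have wc : Continuous (fun x : EuclideanSpace ℝ (Fin d) => (‖x‖ ^ 2 + ε)⁻¹) :=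
        ((continuous_norm.pow 2).add continuous_const).inv₀ fun x => (wpos x).ne'
      exact ((hu.continuous.pow 2).mul wc).aestronglyMeasurable
    · have hw : 0 < (‖x‖ ^ 2 + ε)⁻¹ := inv_pos.2 (wpos x)
      rw [Real.norm_eq_abs, abs_of_nonneg (by positivity)]
      exact mul_le_mul_of_nonneg_left (reg_inv_le hε) (sq_nonneg _)
  refine ⟨I4, ?_⟩
  set N := (d : ℝ) - 2 with hNdef
  have key : ∫ x : EuclideanSpace ℝ (Fin d), (N ^ 2 / 4 * (u x ^ 2 * (‖x‖ ^ 2 + ε)⁻¹)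
      + N ^ 2 / 4 * (u x ^ 2 * (‖x‖ ^ 2 + ε)⁻¹)) ≤
      ∫ x : EuclideanSpace ℝ (Fin d), (‖fderiv ℝ u x‖ ^ 2
        + N / 2 * (2 * u x * fderiv ℝ u x x * (‖x‖ ^ 2 + ε)⁻¹)
        + N / 2 * (u x ^ 2 * (d * (‖x‖ ^ 2 + ε)⁻¹ - 2 * ‖x‖ ^ 2 * ((‖x‖ ^ 2 + ε)⁻¹) ^ 2))
        + N ^ 2 / 4 * (u x ^ 2 * (‖x‖ ^ 2 + ε)⁻¹)) := by
    refine integral_mono ((I4.const_mul _).add (I4.const_mul _))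
      (((iD.add (I1.const_mul _)).add (I2.const_mul _)).add (I4.const_mul _)) fun x => ?_
    have hw : 0 < (‖x‖ ^ 2 + ε)⁻¹ := inv_pos.2 (wpos x)
    have hw3 := reg_sq (X := ‖x‖) hε
    have h1 : |fderiv ℝ u x x| ≤ ‖fderiv ℝ u x‖ * ‖x‖ := (fderiv ℝ u x).le_opNorm x
    simp only
    set w := (‖x‖ ^ 2 + ε)⁻¹
    have hd2 : (d : ℝ) = N + 2 := by rw [hNdef]; ring
    have h2 : -(|u x| * (‖fderiv ℝ u x‖ * ‖x‖)) ≤ u x * fderiv ℝ u x x := by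
      have := mul_le_mul_of_nonneg_left h1 (abs_nonneg (u x))
      rw [← abs_mul] at this
      linarith [neg_abs_le (u x * fderiv ℝ u x x)]
    have h3 := mul_le_mul_of_nonneg_left h2 (mul_nonneg hN hw.le)
    have h4 : 0 ≤ (‖fderiv ℝ u x‖ - N / 2 * |u x| * ‖x‖ * w) ^ 2 := sq_nonneg _
    have h5 : |u x| ^ 2 = u x ^ 2 := sq_abs _
    have h6 : ‖x‖ ^ 2 * w ^ 2 ≤ w := by nlinarith
    have h7 : 0 ≤ u x ^ 2 * (w - ‖x‖ ^ 2 * w ^ 2) := mul_nonneg (sq_nonneg _) (by linarith)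
    have h8 : 0 ≤ N ^ 2 / 4 * (u x ^ 2 * (w - ‖x‖ ^ 2 * w ^ 2)) := by positivity
    have h9 : 0 ≤ N * (u x ^ 2 * (w - ‖x‖ ^ 2 * w ^ 2)) := by positivity
    have h10 : (‖fderiv ℝ u x‖ - N / 2 * |u x| * ‖x‖ * w) ^ 2 = ‖fderiv ℝ u x‖ ^ 2
        - N * w * (|u x| * (‖fderiv ℝ u x‖ * ‖x‖)) + N ^ 2 / 4 * u x ^ 2 * (‖x‖ ^ 2 * w ^ 2) := by
      rw [← h5]; ring
    rw [h10] at h4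
    rw [hd2]
    nlinarith
  have J1 : Integrable (fun x : EuclideanSpace ℝ (Fin d) => ‖fderiv ℝ u x‖ ^ 2
        + N / 2 * (2 * u x * fderiv ℝ u x x * (‖x‖ ^ 2 + ε)⁻¹)) := iD.add (I1.const_mul _)
  have J2 : Integrable (fun x : EuclideanSpace ℝ (Fin d) => ‖fderiv ℝ u x‖ ^ 2
        + N / 2 * (2 * u x * fderiv ℝ u x x * (‖x‖ ^ 2 + ε)⁻¹)
        + N / 2 * (u x ^ 2 * (d * (‖x‖ ^ 2 + ε)⁻¹ - 2 * ‖x‖ ^ 2 * ((‖x‖ ^ 2 + ε)⁻¹) ^ 2))) :=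
    J1.add (I2.const_mul _)
  rw [integral_add (I4.const_mul _) (I4.const_mul _), integral_add J2 (I4.const_mul _),
    integral_add J1 (I2.const_mul _), integral_add iD (I1.const_mul _)] at key
  simp only [integral_const_mul] at key
  rw [I3] at key
  linarith

lemma hardy (hd : 3 ≤ d) (hu : Differentiable ℝ u) (h2 : MemLp u 2 volume)
    (hD : MemLp (fun x => fderiv ℝ u x) 2 volume) :
    Integrable (fun x : EuclideanSpace ℝ (Fin d) => u x ^ 2 / ‖x‖ ^ 2) ∧
    ((d : ℝ) - 2) ^ 2 / 4 * ∫ x : EuclideanSpace ℝ (Fin d), u x ^ 2 / ‖x‖ ^ 2 ≤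
      ∫ x : EuclideanSpace ℝ (Fin d), ‖fderiv ℝ u x‖ ^ 2 := by
  have : Nonempty (Fin d) := ⟨⟨0, by omega⟩⟩
  have hN : (0 : ℝ) < ((d : ℝ) - 2) ^ 2 / 4 := by
    have : (3 : ℝ) ≤ d := by exact_mod_cast hd
    have : (0 : ℝ) < (d : ℝ) - 2 := by linarith
    positivity
  set K := ((d : ℝ) - 2) ^ 2 / 4 with hK
  set J := ∫ x : EuclideanSpace ℝ (Fin d), ‖fderiv ℝ u x‖ ^ 2 with hJ
  have hJ0 : 0 ≤ J := integral_nonneg fun x => by positivity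
  set ε : ℕ → ℝ := fun n => 1 / ((n : ℝ) + 1) with hε
  have hε0 : ∀ n, 0 < ε n := fun n => by simp only [hε]; positivity
  have hreg := fun n => hardy_reg (by omega) hu h2 hD (hε0 n)
  have cn : ∀ n, ∫⁻ x : EuclideanSpace ℝ (Fin d), ENNReal.ofReal (u x ^ 2 * (‖x‖ ^ 2 + ε n)⁻¹) ≤
      ENNReal.ofReal (J / K) := fun n => by
    rw [← ofReal_integral_eq_lintegral_ofReal (hreg n).1 (Eventually.of_forall fun x => by
      have := hε0 n
      simp only [Pi.zero_apply]; positivity)]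
    apply ENNReal.ofReal_le_ofReal
    rw [le_div_iff₀ hN, mul_comm]
    exact (hreg n).2
  have lim : Tendsto (fun n => ∫⁻ x : EuclideanSpace ℝ (Fin d),
      ENNReal.ofReal (u x ^ 2 * (‖x‖ ^ 2 + ε n)⁻¹)) atTop
      (𝓝 (∫⁻ x : EuclideanSpace ℝ (Fin d), ENNReal.ofReal (u x ^ 2 / ‖x‖ ^ 2))) := by
    refine lintegral_tendsto_of_tendsto_of_monotone
      (fun n => (hreg n).1.1.aemeasurable.ennreal_ofReal) ?_ ?_
    · refine Eventually.of_forall fun x n k hnk => ENNReal.ofReal_le_ofReal ?_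
      refine mul_le_mul_of_nonneg_left ?_ (sq_nonneg _)
      have h3 : ε k ≤ ε n := one_div_le_one_div_of_le (by positivity) (by gcongr)
      exact inv_anti₀ (by have := hε0 k; positivity) (by linarith)
    · have hne : ∀ᵐ x : EuclideanSpace ℝ (Fin d), x ≠ 0 := by
        simp [ae_iff]
      filter_upwards [hne] with x hx
      refine ENNReal.tendsto_ofReal ?_
      rw [div_eq_mul_inv]
      refine Tendsto.const_mul _ (Tendsto.inv₀ ?_ (by positivity))
      simpa [hε] using (tendsto_one_div_add_atTop_nhds_zero_nat (𝕜 := ℝ)).const_add (‖x‖ ^ 2)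
  have fin := le_of_tendsto' lim cn
  have meas : AEStronglyMeasurable (fun x : EuclideanSpace ℝ (Fin d) => u x ^ 2 / ‖x‖ ^ 2) volume :=
    ((hu.continuous.measurable.pow_const 2).div (measurable_norm.pow_const 2)).aestronglyMeasurable
  have nn : 0 ≤ᵐ[volume] (fun x : EuclideanSpace ℝ (Fin d) => u x ^ 2 / ‖x‖ ^ 2) :=
    Eventually.of_forall fun x => by simp only [Pi.zero_apply]; positivity
  have I : Integrable (fun x : EuclideanSpace ℝ (Fin d) => u x ^ 2 / ‖x‖ ^ 2) :=
    ⟨meas, (hasFiniteIntegral_iff_ofReal nn).2 (fin.trans_lt ENNReal.ofReal_lt_top)⟩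
  refine ⟨I, ?_⟩
  rw [← ofReal_integral_eq_lintegral_ofReal I nn,
    ENNReal.ofReal_le_ofReal_iff (by positivity), le_div_iff₀ hN, mul_comm] at fin
  exact fin

end Hardy

lemma part_3 (d : ℕ) (hd : 11 ≤ d) (p : ℝ) (hp1 : 1 < p)
    (hp : pJL d < p) (Q : ℝ → ℝ) (hQ : IsGroundState d p Q)
    (u : EuclideanSpace ℝ (Fin d) → ℝ) (hu : Differentiable ℝ u)
    (h2 : MemLp u 2 volume) (hD : MemLp (fun x => fderiv ℝ u x) 2 volume) :
    discr d p / 4 * ∫ x : EuclideanSpace ℝ (Fin d), (u x) ^ 2 / ‖x‖ ^ 2 ≤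
          ∫ x : EuclideanSpace ℝ (Fin d),
            (‖fderiv ℝ u x‖ ^ 2 - p * Q ‖x‖ ^ (p - 1) * (u x) ^ 2) := by
  have : Nonempty (Fin d) := ⟨⟨0, by omega⟩⟩
  obtain ⟨I, H⟩ := hardy (by omega) hu h2 hD
  have iD : Integrable (fun x => ‖fderiv ℝ u x‖ ^ 2) := hD.norm.integrable_sq
  set κ := cInfty d p ^ (p - 1) with hκ
  have bd : ∀ᵐ x : EuclideanSpace ℝ (Fin d),
      p * Q ‖x‖ ^ (p - 1) * (u x) ^ 2 ≤ p * κ * (u x ^ 2 / ‖x‖ ^ 2) := by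
    have hne : ∀ᵐ x : EuclideanSpace ℝ (Fin d), x ≠ 0 := by
      simp [ae_iff]
    filter_upwards [hne] with x hx
    have h1 := Q_pow_le d hd p hp1 hp Q hQ ‖x‖ (norm_pos_iff.2 hx)
    calc _ ≤ p * (κ / ‖x‖ ^ 2) * (u x) ^ 2 := by gcongr
      _ = _ := by ring
  have qc : Continuous (fun x : EuclideanSpace ℝ (Fin d) => Q ‖x‖ ^ (p - 1)) :=
    (hQ.smooth.continuous.comp continuous_norm).rpow_const
      fun x => Or.inl (hQ.pos _ (norm_nonneg x)).ne'
  have IQ : Integrable (fun x : EuclideanSpace ℝ (Fin d) => p * Q ‖x‖ ^ (p - 1) * (u x) ^ 2) := by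
    refine (I.const_mul (p * κ)).mono' ((continuous_const.mul qc).mul
      (hu.continuous.pow 2)).aestronglyMeasurable ?_
    filter_upwards [bd] with x hx
    have h1 : 0 < Q ‖x‖ ^ (p - 1) := Real.rpow_pos_of_pos (hQ.pos _ (norm_nonneg x)) _
    rw [Real.norm_eq_abs, abs_of_nonneg (by positivity)]
    exact hx
  rw [integral_sub iD IQ]
  have h3 := integral_mono_ae IQ (I.const_mul (p * κ)) bd
  rw [integral_const_mul] at h3
  unfold discr
  rw [← hκ]
  linarith

/-- **Asymptotic expansion of the ground state** (Lemma 2.1): for `d ≥ 11` and `p > p_JL`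
there exist `a₁ ≠ 0`, `c ≠ 0` and `δ(p) > 0` such that, for every `0 < g < min(α, α₂-α)`
and every `k ∈ ℕ`:
(i) `∂_y^k Q = ∂_y^k [c_∞ y^{-2/(p-1)} + a₁ y^{-γ}] + O(y^{-γ-g-k})` as `y → ∞`;
(ii) `∂_y^k Λ⁽¹⁾Q = ∂_y^k [c y^{-γ}] + O(y^{-γ-g-k})` as `y → ∞`;
(iii) `∫ (|∇u|² - pQ^{p-1}u²) ≥ δ(p) ∫ u²/|y|²` for every `u ∈ H¹(ℝ^d)`;
(iv) `Λ⁽¹⁾Q > 0`. -/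
theorem ground_state_asymptotic_expansion (d : ℕ) (hd : 11 ≤ d) (p : ℝ) (hp1 : 1 < p)
    (hp : pJL d < p) (Q : ℝ → ℝ) (hQ : IsGroundState d p Q) :
    ∃ a₁ c δp : ℝ, a₁ ≠ 0 ∧ c ≠ 0 ∧ 0 < δp ∧
      (∀ g : ℝ, 0 < g → g < min (alph d p) (alph₂ d p - alph d p) → ∀ k : ℕ,
        ((fun y : ℝ => iteratedDeriv k Q y -
            iteratedDeriv k
              (fun z : ℝ => cInfty d p * z ^ (-(2 / (p - 1))) + a₁ * z ^ (-(gam d p))) y)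
          =O[atTop] fun y : ℝ => y ^ (-(gam d p) - g - (k : ℝ))) ∧
        ((fun y : ℝ => iteratedDeriv k (Lam1 p Q) y -
            iteratedDeriv k (fun z : ℝ => c * z ^ (-(gam d p))) y)
          =O[atTop] fun y : ℝ => y ^ (-(gam d p) - g - (k : ℝ)))) ∧
      (∀ u : EuclideanSpace ℝ (Fin d) → ℝ, Differentiable ℝ u →
        MemLp u 2 volume → MemLp (fun x => fderiv ℝ u x) 2 volume →
        δp * ∫ x : EuclideanSpace ℝ (Fin d), (u x) ^ 2 / ‖x‖ ^ 2 ≤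
          ∫ x : EuclideanSpace ℝ (Fin d),
            (‖fderiv ℝ u x‖ ^ 2 - p * Q ‖x‖ ^ (p - 1) * (u x) ^ 2)) ∧
      (∀ y : ℝ, 0 ≤ y → 0 < Lam1 p Q y) := by
  obtain ⟨a₁, c, ha, hc, H⟩ := parts_12 d hd p hp1 hp Q hQ
  obtain ⟨-, -, -, -, hdis, -⟩ := consts d hd p hp1 hp
  exact ⟨a₁, c, discr d p / 4, ha, hc, by positivity, H,
    fun u hu h2 hD => part_3 d hd p hp1 hp Q hQ u hu h2 hD,
    fun y hy => part_4 d hd p hp1 hp Q hQ y hy⟩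

end WaveBlowup
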